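/- Let (Ω, F) be a measurable space, let p' be a measure on it and let p = p'.withDensity f be a probability measure, where f : Ω → [0, ∞) is measurable (so f is the density of p with respect to p'). Fix ε ∈ ℝ and δ ≥ 0, and suppose p({ o : f(o) > e^ε }) ≤ δ. Then for every measurable set S ⊆ Ω, p(S) ≤ e^ε · p'(S) + δ. -/

import Mathlib

open MeasureTheory Real

/-- A measure with density `f` is at most `c` times the base measure, up to the mass of `{c < f}`. -/
theorem MeasureTheory.withDensity_apply_le_mul_add {Ω : Type*} [MeasurableSpace Ω]
    {μ : Measure Ω} {f : Ω → ENNReal} (hf : Measurable f) (c : ENNReal)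
    {S : Set Ω} (hS : MeasurableSet S) :
    μ.withDensity f S ≤ c * μ S + μ.withDensity f {o | c < f o} := by
  have hT : MeasurableSet {o | c < f o} := measurableSet_lt measurable_const hf
  calc μ.withDensity f S
      ≤ μ.withDensity f (S \ {o | c < f o}) + μ.withDensity f {o | c < f o} := by
        rw [← measure_sdiff_add_inter S hT]
        gcongr
        exact Set.inter_subset_right
    _ ≤ c * μ S + μ.withDensity f {o | c < f o} := by
        gcongr
        rw [withDensity_apply _ (hS.diff hT)]
        calc ∫⁻ o in S \ {o | c < f o}, f o ∂μ
            ≤ ∫⁻ _ in S \ {o | c < f o}, c ∂μ :=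
              setLIntegral_mono measurable_const fun _ ho => not_lt.mp ho.2
          _ = c * μ (S \ {o | c < f o}) := setLIntegral_const _ _
          _ ≤ c * μ S := by gcongr; exact Set.sdiff_subset

/-- tail bound to (ε, δ)-DP conversion: if `p = p'.withDensity f`
is a probability measure and the privacy-loss tail satisfies
`p({f > e^ε}) ≤ δ`, then `p(S) ≤ e^ε p'(S) + δ` for every measurable `S`. -/
theorem statement8 {Ω : Type*} [MeasurableSpace Ω]
    (p' : Measure Ω) (f : Ω → ENNReal) (hf : Measurable f)
    (p : Measure Ω) (hp : p = p'.withDensity f) [IsProbabilityMeasure p]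
    (ε δ : ℝ) (hδ : 0 ≤ δ)
    (htail : p {o | ENNReal.ofReal (Real.exp ε) < f o} ≤ ENNReal.ofReal δ) :
    ∀ S : Set Ω, MeasurableSet S →
      p S ≤ ENNReal.ofReal (Real.exp ε) * p' S + ENNReal.ofReal δ := by
  intro S hS
  subst hp
  exact (withDensity_apply_le_mul_add hf _ hS).trans (by gcongr)
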